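/- Let F be a proper filter in S and let s ∈ F. Then F = ↑{s·x : x ∈ d(F)}, i.e. F equals the up-set generated by the products of s with elements of the source filter d(F) = F⁻¹·F. -/

import Mathlib

/-- An inverse semigroup with zero: every element `a` has a unique `a⁻¹` with
`a * a⁻¹ * a = a` and `a⁻¹ * a * a⁻¹ = a⁻¹`, and `0` is absorbing. -/
class InvSemigroupWithZero (S : Type*) extends Semigroup S, Zero S, Inv S where
  mul_inv_mul : ∀ a : S, a * a⁻¹ * a = a
  inv_mul_inv : ∀ a : S, a⁻¹ * a * a⁻¹ = a⁻¹
  inv_unique : ∀ a b : S, a * b * a = a → b * a * b = b → b = a⁻¹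
  zero_mul : ∀ a : S, 0 * a = 0
  mul_zero : ∀ a : S, a * 0 = 0

namespace InvSemigroupWithZero

variable {S : Type*} [InvSemigroupWithZero S]

/-- The natural partial order on `S`: `a ≤ b` iff `a = a * a⁻¹ * b`. -/
def sle (a b : S) : Prop := a = a * a⁻¹ * b

/-- `↓s`, the down-set of `s` w.r.t. the natural partial order. -/
def dwn (s : S) : Set S := {t : S | sle t s}

/-- `↑A`, the up-set generated by `A` w.r.t. the natural partial order. -/
def up (A : Set S) : Set S := {b : S | ∃ a ∈ A, sle a b}

/-- A filter in `S`: a nonempty down-directed up-set. -/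
def IsFilt (F : Set S) : Prop :=
  F.Nonempty ∧ up F = F ∧ ∀ a ∈ F, ∀ b ∈ F, ∃ c ∈ F, sle c a ∧ sle c b

/-- A proper filter: a filter not containing `0`. -/
def IsPFilt (F : Set S) : Prop := IsFilt F ∧ (0 : S) ∉ F

/-- An ultrafilter: a proper filter maximal among proper filters. -/
def IsUltra (U : Set S) : Prop :=
  IsPFilt U ∧ ∀ G : Set S, IsPFilt G → U ⊆ G → U = G

/-- The set `E` of idempotents of `S`. -/
def E (S : Type*) [InvSemigroupWithZero S] : Set S := {e : S | e * e = e}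

/-- `F⁻¹ = {a⁻¹ : a ∈ F}`. -/
def finv (F : Set S) : Set S := (fun a : S => a⁻¹) '' F

/-- `F · G = ↑{fg : f ∈ F, g ∈ G}`. -/
def fmul (F G : Set S) : Set S := up (Set.image2 (· * ·) F G)

/-- The source `d(F) := F⁻¹ · F`. -/
def src (F : Set S) : Set S := fmul (finv F) F

/-- The range `r(F) := F · F⁻¹`. -/
def rng (F : Set S) : Set S := fmul F (finv F)

/-- The natural partial order on the idempotents: `e ≤ f` iff `e = e * f`. -/
def ele (e f : S) : Prop := e = e * f

/-- The down-set of an idempotent `e` inside `E`. -/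
def edwn (e : S) : Set S := {f : S | f ∈ E S ∧ ele f e}

/-- The up-set generated by `A` inside `E`. -/
def eup (A : Set S) : Set S := {f : S | f ∈ E S ∧ ∃ a ∈ A, ele a f}

/-- An `E`-filter: a proper filter of the inverse semigroup `E` of idempotents. -/
def IsEFilt (ξ : Set S) : Prop :=
  ξ ⊆ E S ∧ ξ.Nonempty ∧ eup ξ = ξ ∧
    (∀ a ∈ ξ, ∀ b ∈ ξ, ∃ c ∈ ξ, ele c a ∧ ele c b) ∧ (0 : S) ∉ ξ

/-- An `E`-ultrafilter: an `E`-filter maximal among `E`-filters. -/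
def IsEUltra (ξ : Set S) : Prop :=
  IsEFilt ξ ∧ ∀ η : Set S, IsEFilt η → ξ ⊆ η → ξ = η

/-- `β_s(ξ) = {f ∈ E : s·e·s⁻¹ ≤ f for some e ∈ ξ}`. -/
def beta (s : S) (ξ : Set S) : Set S :=
  {f : S | f ∈ E S ∧ ∃ e ∈ ξ, sle (s * e * s⁻¹) f}

/-- The set of proper filters in `S`. -/
abbrev PFilt (S : Type*) [InvSemigroupWithZero S] := {F : Set S // IsPFilt F}

/-- The patch topology on the set of proper filters, generated by the sets
`F(s;T) = {F : s ∈ F, F ∩ T = ∅}` for `s ∈ S` and finite `T ⊆ ↓s`. -/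
instance patchTopology : TopologicalSpace (PFilt S) :=
  TopologicalSpace.generateFrom
    {O : Set (PFilt S) | ∃ (s : S) (T : Set S), T.Finite ∧ T ⊆ dwn s ∧
      O = {F : PFilt S | s ∈ F.1 ∧ F.1 ∩ T = ∅}}

/-- The set of idempotent proper filters in `S`. -/
abbrev IPFilt (S : Type*) [InvSemigroupWithZero S] :=
  {F : Set S // IsPFilt F ∧ (F ∩ E S).Nonempty}

/-- The subspace topology induced by the patch topology on proper filters. -/
instance : TopologicalSpace (IPFilt S) :=
  TopologicalSpace.induced (fun F => (⟨F.1, F.2.1⟩ : PFilt S)) inferInstance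

/-- The set of `E`-filters. -/
abbrev EFilt (S : Type*) [InvSemigroupWithZero S] := {ξ : Set S // IsEFilt ξ}

/-- The patch topology on the set of `E`-filters, generated by the sets
`P(e;X) = {ξ : e ∈ ξ, ξ ∩ X = ∅}` for `e ∈ E` and finite `X ⊆ ↓e ∩ E`. -/
instance : TopologicalSpace (EFilt S) :=
  TopologicalSpace.generateFrom
    {O : Set (EFilt S) | ∃ (e : S) (X : Set S), e ∈ E S ∧ X.Finite ∧ X ⊆ edwn e ∧
      O = {ξ : EFilt S | e ∈ ξ.1 ∧ ξ.1 ∩ X = ∅}}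

/-- The set of ultrafilters in `S`. -/
abbrev UFilt (S : Type*) [InvSemigroupWithZero S] := {U : Set S // IsUltra U}

/-- The subspace topology induced by the patch topology on proper filters. -/
instance : TopologicalSpace (UFilt S) :=
  TopologicalSpace.induced (fun U => (⟨U.1, U.2.1⟩ : PFilt S)) inferInstance

end InvSemigroupWithZero

open InvSemigroupWithZero

namespace InvSemigroupWithZero

section NaturalOrder

variable {S : Type*} [InvSemigroupWithZero S]

theorem inv_eq_of_mul {a b : S} (h₁ : a * b * a = a) (h₂ : b * a * b = b) : a⁻¹ = b :=
  (inv_unique a b h₁ h₂).symm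

theorem mul_self_mul_inv (a : S) : (a * a⁻¹) * (a * a⁻¹) = a * a⁻¹ := by
  rw [← mul_assoc, mul_inv_mul]

theorem inv_mul_mul_self (a : S) : (a⁻¹ * a) * (a⁻¹ * a) = a⁻¹ * a := by
  rw [← mul_assoc, inv_mul_inv]

theorem mul_idem_of_idem {e f : S} (he : e * e = e) (hf : f * f = f) :
    (e * f) * (e * f) = e * f := by
  have h₁ := mul_inv_mul (e * f)
  have h₂ := inv_mul_inv (e * f)
  have hx : (e * f)⁻¹ = f * (e * f)⁻¹ * e := by
    apply inv_eq_of_mul <;> grind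
  have hxx : (e * f)⁻¹ * (e * f)⁻¹ = (e * f)⁻¹ := by grind
  generalize (e * f)⁻¹ = x at *
  have h₃ : e * f = x⁻¹ := inv_unique x (e * f) h₂ h₁
  have h₄ : x = x⁻¹ := inv_unique x x (by rw [hxx, hxx]) (by rw [hxx, hxx])
  rw [h₃, ← h₄, hxx]

theorem mul_comm_of_idem {e f : S} (he : e * e = e) (hf : f * f = f) : e * f = f * e := by
  have h₁ := mul_idem_of_idem he hf
  have h₂ := mul_idem_of_idem hf he
  rw [inv_unique (e * f) (e * f) (by rw [h₁, h₁]) (by rw [h₁, h₁])]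
  apply inv_eq_of_mul <;> grind

theorem conj_idem (b : S) {e : S} (he : e * e = e) :
    (b * e * b⁻¹) * (b * e * b⁻¹) = b * e * b⁻¹ := by
  have h := mul_comm_of_idem he (inv_mul_mul_self b)
  have h₁ := mul_inv_mul b
  grind

theorem mul_idem_eq_conj_mul (b : S) {e : S} (he : e * e = e) :
    b * e = (b * e * b⁻¹) * b := by
  have h := mul_comm_of_idem he (inv_mul_mul_self b)
  have h₁ := mul_inv_mul b
  grind

theorem inv_idem_mul (b : S) {e : S} (he : e * e = e) : (e * b)⁻¹ = b⁻¹ * e := by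
  have h := mul_comm_of_idem he (mul_self_mul_inv b)
  have h₁ := mul_inv_mul b
  have h₂ := inv_mul_inv b
  apply inv_eq_of_mul <;> grind

theorem sle_iff_exists_idem {a b : S} : sle a b ↔ ∃ e : S, e * e = e ∧ a = e * b := by
  constructor
  · exact fun h => ⟨a * a⁻¹, mul_self_mul_inv a, h⟩
  · rintro ⟨e, he, rfl⟩
    have h := mul_comm_of_idem he (mul_self_mul_inv b)
    have h₁ := mul_inv_mul b
    rw [sle, inv_idem_mul b he]
    grind

theorem sle.trans {a b c : S} (hab : sle a b) (hbc : sle b c) : sle a c := by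
  obtain ⟨e, he, rfl⟩ := sle_iff_exists_idem.1 hab
  obtain ⟨f, hf, rfl⟩ := sle_iff_exists_idem.1 hbc
  exact sle_iff_exists_idem.2 ⟨e * f, mul_idem_of_idem he hf, (mul_assoc ..).symm⟩

theorem sle_refl (a : S) : sle a a := (mul_inv_mul a).symm

theorem sle.mul {a b c d : S} (hab : sle a b) (hcd : sle c d) : sle (a * c) (b * d) := by
  obtain ⟨e, he, rfl⟩ := sle_iff_exists_idem.1 hab
  obtain ⟨f, hf, rfl⟩ := sle_iff_exists_idem.1 hcd
  refine sle_iff_exists_idem.2 ⟨e * (b * f * b⁻¹), mul_idem_of_idem he (conj_idem b hf), ?_⟩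
  have h := mul_idem_eq_conj_mul b hf
  grind

theorem sle.inv {a b : S} (hab : sle a b) : sle a⁻¹ b⁻¹ := by
  obtain ⟨e, he, rfl⟩ := sle_iff_exists_idem.1 hab
  rw [inv_idem_mul b he, mul_idem_eq_conj_mul b⁻¹ he]
  exact sle_iff_exists_idem.2 ⟨_, conj_idem b⁻¹ he, rfl⟩

theorem sle.eq_mul_inv_mul {a b : S} (hab : sle a b) : a = b * (a⁻¹ * a) := by
  obtain ⟨e, he, rfl⟩ := sle_iff_exists_idem.1 hab
  have h := mul_comm_of_idem he (mul_self_mul_inv b)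
  have h₁ := mul_inv_mul b
  rw [inv_idem_mul b he]
  grind

end NaturalOrder

end InvSemigroupWithZero

/-- If `F` is a proper filter and `s ∈ F`, then `F = ↑{s·x : x ∈ d(F)}`. -/
theorem stmt_5 {S : Type*} [InvSemigroupWithZero S]
    (F : Set S) (hF : IsPFilt F) (s : S) (hs : s ∈ F) :
    F = up {x : S | ∃ e ∈ src F, x = s * e} := by
  obtain ⟨⟨-, hup, hdir⟩, -⟩ := hF
  ext t
  constructor
  · intro ht
    obtain ⟨c, hc, hcs, hct⟩ := hdir s hs t ht
    refine ⟨c, ⟨c⁻¹ * c, ?_, hcs.eq_mul_inv_mul⟩, hct⟩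
    exact ⟨c⁻¹ * c, ⟨c⁻¹, ⟨c, hc, rfl⟩, c, hc, rfl⟩, sle_refl _⟩
  · rintro ⟨_, ⟨x, ⟨_, ⟨_, ⟨a, ha, rfl⟩, b, hb, rfl⟩, hx⟩, rfl⟩, ht⟩
    obtain ⟨c, hc, hca, hcb⟩ := hdir a ha b hb
    obtain ⟨d, hd, hds, hdc⟩ := hdir s hs c hc
    rw [← hup]
    refine ⟨d, hd, sle.trans ?_ ht⟩
    have h := hds.mul (((hdc.trans hca).inv.mul (hdc.trans hcb)).trans hx)
    rwa [← mul_assoc, mul_inv_mul] at h
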